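/- Let G be a connected simple graph on [N] with an edge e = uv such that deg_G(u) = 2, and let d = (d_1,…,d_{N+1}) be a D(G△e)-draconian sequence with d_{N+1} = 2. Then both the sequence obtained from (d_1,…,d_N) by increasing the entry d_u by 1, and the sequence obtained from (d_1,…,d_N) by increasing the entry d_v by 1, are D(G)-draconian sequences. -/

import Mathlib

open Finset

attribute [local instance] Classical.propDecidable

/-- The set of neighbors of `i` in `G`, as a `Finset`. -/
noncomputable def nbr {N : ℕ} (G : SimpleGraph (Fin N)) (i : Fin N) : Finset (Fin N) :=
  Finset.univ.filter (fun j => G.Adj i j)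

/-- `(a 1, …, a N)` is a `D(G)`-draconian sequence: the entries sum to `N - 1` and for
every nonempty `S ⊆ [N]` one has `∑_{i ∈ S} a i < |S ∪ ⋃_{i ∈ S} N_G(i)|`. -/
def draconian {N : ℕ} (G : SimpleGraph (Fin N)) (a : Fin N → ℕ) : Prop :=
  (∑ i, a i) = N - 1 ∧
  ∀ S : Finset (Fin N), S.Nonempty →
    (∑ i ∈ S, a i) < (S ∪ S.biUnion (fun i => nbr G i)).card

/-- The subdivision `G : e` of the edge `e = uv` of `G`: the graph on `[N+1]` with edge
set `(E(G) ∖ {uv}) ∪ {u(N+1), v(N+1)}`. -/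
def subdiv {N : ℕ} (G : SimpleGraph (Fin N)) (u v : Fin N) : SimpleGraph (Fin (N + 1)) :=
  SimpleGraph.fromRel (fun i j =>
    (∃ a b : Fin N, i = a.castSucc ∧ j = b.castSucc ∧ G.Adj a b ∧
      ¬(a = u ∧ b = v) ∧ ¬(a = v ∧ b = u))
    ∨ (i = u.castSucc ∧ j = Fin.last N) ∨ (i = v.castSucc ∧ j = Fin.last N))

/-- The graph `G △ e` for an edge `e = uv` of `G`: the graph on `[N+1]` with edge set
`E(G) ∪ {u(N+1), v(N+1)}`. -/
def triExt {N : ℕ} (G : SimpleGraph (Fin N)) (u v : Fin N) : SimpleGraph (Fin (N + 1)) :=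
  SimpleGraph.fromRel (fun i j =>
    (∃ a b : Fin N, i = a.castSucc ∧ j = b.castSucc ∧ G.Adj a b)
    ∨ (i = u.castSucc ∧ j = Fin.last N) ∨ (i = v.castSucc ∧ j = Fin.last N))

/-- A graph on `[N]` is `2`-connected if it has at least `3` vertices, is connected, and
remains connected after deleting any single vertex. -/
def TwoConnected {N : ℕ} (G : SimpleGraph (Fin N)) : Prop :=
  3 ≤ N ∧ G.Connected ∧
    ∀ v : Fin N, (G.comap (fun u : {w : Fin N // w ≠ v} => (u : Fin N))).Connected

theorem mem_nbr {N : ℕ} {G : SimpleGraph (Fin N)} {i j : Fin N} : j ∈ nbr G i ↔ G.Adj i j := by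
  simp [nbr]

section TriExt

variable {N : ℕ} {G : SimpleGraph (Fin N)} {u v : Fin N}

theorem triExt_adj_castSucc {a b : Fin N} :
    (triExt G u v).Adj a.castSucc b.castSucc ↔ G.Adj a b := by
  have hne (x : Fin N) : x.castSucc ≠ Fin.last N := Fin.castSucc_ne_last x
  simp only [triExt, SimpleGraph.fromRel_adj, hne, and_false, or_false, Fin.castSucc_inj]
  constructor
  · rintro ⟨-, ⟨x, y, rfl, rfl, h⟩ | ⟨x, y, rfl, rfl, h⟩⟩
    exacts [h, h.symm]
  · exact fun h => ⟨by simpa using h.ne, Or.inl ⟨a, b, rfl, rfl, h⟩⟩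

theorem triExt_adj_last {a : Fin N} :
    (triExt G u v).Adj a.castSucc (Fin.last N) ↔ a = u ∨ a = v := by
  have hne (x : Fin N) : Fin.last N ≠ x.castSucc := (Fin.castSucc_ne_last x).symm
  simp [triExt, SimpleGraph.fromRel_adj, hne, Fin.castSucc_ne_last]

/-- Adding the new vertex to a set whose closed neighborhood contains `u` and `v` enlarges the
closed neighborhood by the new vertex only. -/
theorem draconian.sum_add_last_le {d : Fin (N + 1) → ℕ} (hd : draconian (triExt G u v) d)
    {S : Finset (Fin N)} (hu : u ∈ S ∪ S.biUnion fun i => nbr G i)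
    (hv : v ∈ S ∪ S.biUnion fun i => nbr G i) :
    ∑ i ∈ S, Fin.init d i + d (Fin.last N) ≤ (S ∪ S.biUnion fun i => nbr G i).card := by
  have hlt := hd.2 (insert (Fin.last N) (S.map Fin.castSuccEmb)) (insert_nonempty _ _)
  rw [sum_insert (by simp [Fin.castSucc_ne_last]), sum_map] at hlt
  have hsub := card_le_card (s := insert (Fin.last N) (S.map Fin.castSuccEmb) ∪
      (insert (Fin.last N) (S.map Fin.castSuccEmb)).biUnion fun i => nbr (triExt G u v) i)
    (t := insert (Fin.last N) ((S ∪ S.biUnion fun i => nbr G i).map Fin.castSuccEmb)) (by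
      intro x
      refine Fin.lastCases (by simp) (fun x => ?_) x
      simp only [mem_union, mem_biUnion, mem_insert, mem_map, mem_nbr, exists_eq_or_imp,
        Fin.castSucc_ne_last, false_or, (triExt G u v).adj_comm (Fin.last N), triExt_adj_last,
        exists_exists_and_eq_and, Fin.coe_castSuccEmb, Fin.castSucc_inj, exists_eq_right,
        triExt_adj_castSucc] at hu hv ⊢
      rintro (h | (rfl | rfl) | h)
      exacts [Or.inl h, hu, hv, Or.inr h])
  have hcard := card_insert_le (Fin.last N) ((S ∪ S.biUnion fun i => nbr G i).map Fin.castSuccEmb)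
  rw [card_map] at hcard
  simp only [Fin.coe_castSuccEmb] at hlt
  simp only [Fin.init]
  omega

/-- A set avoiding `u` and `v` has the same closed neighborhood in `G` and in `G△e`. -/
theorem draconian.sum_init_lt {d : Fin (N + 1) → ℕ} (hd : draconian (triExt G u v) d)
    {S : Finset (Fin N)} (hS : S.Nonempty) (hu : u ∉ S) (hv : v ∉ S) :
    ∑ i ∈ S, Fin.init d i < (S ∪ S.biUnion fun i => nbr G i).card := by
  have hlt := hd.2 (S.map Fin.castSuccEmb) (hS.map)
  rw [sum_map] at hlt
  rw [← card_map Fin.castSuccEmb]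
  refine hlt.trans_le (card_le_card fun x => ?_)
  refine Fin.lastCases ?_ (fun x => ?_) x
  · simp only [mem_union, mem_biUnion, mem_map, mem_nbr, exists_exists_and_eq_and,
      Fin.coe_castSuccEmb, triExt_adj_last]
    rintro (⟨a, -, h⟩ | ⟨a, ha, rfl | rfl⟩)
    exacts [absurd h (Fin.castSucc_ne_last a), absurd ha hu, absurd ha hv]
  · simp [mem_nbr, triExt_adj_castSucc]

theorem draconian.update_init (he : G.Adj u v) {d : Fin (N + 1) → ℕ}
    (hd : draconian (triExt G u v) d) (hlast : d (Fin.last N) = 2) {w : Fin N}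
    (hw : w = u ∨ w = v) :
    draconian G (Function.update (Fin.init d) w (Fin.init d w + 1)) := by
  have hsum (S : Finset (Fin N)) (hwS : w ∈ S) :
      ∑ i ∈ S, Function.update (Fin.init d) w (Fin.init d w + 1) i =
        ∑ i ∈ S, Fin.init d i + 1 := by
    rw [sum_update_of_mem hwS, sdiff_singleton_eq_erase, ← add_sum_erase S _ hwS]
    ring
  refine ⟨?_, fun S hS => ?_⟩
  · have h := hd.1
    rw [Fin.sum_univ_castSucc, hlast] at h
    rw [hsum univ (mem_univ w)]
    simp only [Fin.init]
    omega
  · by_cases huv : u ∈ S ∨ v ∈ S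
    · have hle := hd.sum_add_last_le (S := S)
        (by simp only [mem_union, mem_biUnion, mem_nbr]
            exact huv.imp_right fun h => ⟨v, h, he.symm⟩)
        (by simp only [mem_union, mem_biUnion, mem_nbr]
            exact huv.symm.imp_right fun h => ⟨u, h, he⟩)
      by_cases hwS : w ∈ S
      · rw [hsum S hwS]
        omega
      · rw [sum_update_of_notMem hwS]
        omega
    · rw [not_or] at huv
      have hwS : w ∉ S := by
        rcases hw with rfl | rfl
        exacts [huv.1, huv.2]
      rw [sum_update_of_notMem hwS]
      exact hd.sum_init_lt hS huv.1 huv.2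

end TriExt

/-- Let `G` be connected on `[N]` with an edge `e = uv` such that `deg_G(u) = 2`, and let
`d = (d_1, …, d_{N+1})` be `D(G△e)`-draconian with `d_{N+1} = 2`. Then both the sequence
obtained from `(d_1, …, d_N)` by increasing the entry `d u` by `1`, and the one obtained by
increasing the entry `d v` by `1`, are `D(G)`-draconian. -/
theorem draconian_of_triExt_draconian {N : ℕ} (G : SimpleGraph (Fin N)) (hconn : G.Connected)
    (u v : Fin N) (he : G.Adj u v) (hdeg : (nbr G u).card = 2)
    (d : Fin (N + 1) → ℕ) (hd : draconian (triExt G u v) d)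
    (hlast : d (Fin.last N) = 2) :
    draconian G (Function.update (Fin.init d) u (Fin.init d u + 1)) ∧
    draconian G (Function.update (Fin.init d) v (Fin.init d v + 1)) :=
  ⟨hd.update_init he hlast (Or.inl rfl), hd.update_init he hlast (Or.inr rfl)⟩
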